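/- Let A be a finite-dimensional unital algebra over a field k and 𝔑 : A → A a diagonalizable k-algebra automorphism all of whose eigenvalues lie in k. Then the normalized Hochschild chain complex decomposes as a direct sum of subcomplexes C_*(A,A_𝔑) = ⊕_{λ∈Λ} C_*^λ(A,A_𝔑) over the set Λ of products of eigenvalues, and the inclusion of the subcomplex C_*^1(A,A_𝔑) into C_*(A,A_𝔑) induces an isomorphism on homology in every degree; in particular HH_*(A,A_𝔑) ≅ HH_*^1(A,A_𝔑). -/

import Mathlib

open TensorProduct

/-- `Ā = A/(k·1)`. -/
abbrev HBar (k A : Type*) [Field k] [Ring A] [Algebra k A] : Type _ :=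
  A ⧸ (Submodule.span k {(1 : A)})

/-- The canonical projection `A → Ā`. -/
noncomputable def hbar (k : Type*) {A : Type*} [Field k] [Ring A] [Algebra k A] :
    A →ₗ[k] HBar k A := Submodule.mkQ _

/-- The normalized Hochschild chain space `C_p = A ⊗ Ā^{⊗p}`. -/
abbrev HChain (k A : Type*) [Field k] [Ring A] [Algebra k A] (p : ℕ) : Type _ :=
  A ⊗[k] (⨂[k]^p (HBar k A))

/-- The elementary tensor `x ⊗ ā₁ ⊗ ⋯ ⊗ ā_p` in `C_p`. -/
noncomputable def htensor {k A : Type*} [Field k] [Ring A] [Algebra k A] {p : ℕ}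
    (x : A) (a : Fin p → A) : HChain k A p :=
  x ⊗ₜ[k] (PiTensorProduct.tprod k fun i => hbar k (a i))

/-- Merging the entries at positions `i` and `i+1` of a `(p+1)`-tuple by multiplication. -/
def mergeAt {A : Type*} [Mul A] {p : ℕ} (a : Fin (p + 1) → A) (i : Fin p) : Fin p → A :=
  fun j =>
    if (j : ℕ) < (i : ℕ) then a j.castSucc
    else if j = i then a i.castSucc * a i.succ
    else a j.succ

/-- The Hochschild differential on `C_*(A, A_N)`. -/
def IsHochschildDiff (k A : Type*) [Field k] [Ring A] [Algebra k A] (N : A → A)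
    (b : ∀ p : ℕ, HChain k A (p + 1) →ₗ[k] HChain k A p) : Prop :=
  ∀ (p : ℕ) (x : A) (a : Fin (p + 1) → A),
    b p (htensor x a) =
      htensor (x * N (a 0)) (fun i : Fin p => a i.succ)
      + (∑ i : Fin p, ((-1 : ℤ) ^ ((i : ℕ) + 1)) • htensor x (mergeAt a i))
      + ((-1 : ℤ) ^ (p + 1)) • htensor (a (Fin.last p) * x) (fun i : Fin p => a i.castSucc)

/-- The subcomplex `C_p^λ(A,A_N)`. -/
noncomputable def eigChain (k A : Type*) [Field k] [Ring A] [Algebra k A]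
    (N : Module.End k A) (lam : k) (p : ℕ) : Submodule k (HChain k A p) :=
  Submodule.span k
    {z | ∃ (l : k) (ls : Fin p → k) (x : A) (a : Fin p → A),
      x ∈ Module.End.eigenspace N l ∧
      (∀ i, a i ∈ Module.End.eigenspace N (ls i)) ∧
      l * ∏ i, ls i = lam ∧ z = htensor x a}

/-- Two linear maps on Hochschild chains agreeing on elementary tensors are equal. -/
theorem HChain.hom_ext {k A M : Type*} [Field k] [Ring A] [Algebra k A] [AddCommGroup M]
    [Module k M] {p : ℕ} {f g : HChain k A p →ₗ[k] M}
    (h : ∀ (x : A) (a : Fin p → A), f (htensor x a) = g (htensor x a)) : f = g := by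
  refine TensorProduct.ext (LinearMap.ext fun x =>
    PiTensorProduct.ext (MultilinearMap.ext fun v => ?_))
  choose a ha using fun i => Submodule.mkQ_surjective _ (v i)
  obtain rfl : (fun i => hbar k (a i)) = v := funext ha
  exact h x a

section Tuples

variable {k A : Type*} [Field k] [Ring A] [Algebra k A] (N : A ≃ₐ[k] A)

/-- The elementary Hochschild chain on the first `p + 1` entries of a sequence. -/
noncomputable def seqChain (k : Type*) {A : Type*} [Field k] [Ring A] [Algebra k A] (p : ℕ)
    (y : ℕ → A) : HChain k A p :=
  htensor (y 0) (fun i : Fin p => y (i + 1))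

/-- Apply the inverse automorphism to the zeroth entry. -/
def twistZero (y : ℕ → A) (m : ℕ) : A := if m = 0 then N.symm (y 0) else y m

/-- The extra degeneracy. -/
def insertOne (y : ℕ → A) : ℕ → A
  | 0 => 1
  | m + 1 => twistZero N y m

/-- The twisted rotation of the first `p + 1` entries. -/
def twistedRotate (p : ℕ) (y : ℕ → A) (m : ℕ) : A :=
  if m = 0 then twistZero N y p else if m ≤ p then twistZero N y (m - 1) else y m

/-- The `j`-th face of the first `p + 2` entries. -/
def hochschildFace (p j : ℕ) (y : ℕ → A) (m : ℕ) : A :=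
  if j = p + 1 then (if m = 0 then y (p + 1) * y 0 else if m ≤ p then y m else y (m + 1))
  else if m < j then y m
  else if m = j then (if j = 0 then y 0 * N (y 1) else y j * y (j + 1))
  else y (m + 1)

theorem hochschildFace_zero_insertOne (p : ℕ) (y : ℕ → A) :
    hochschildFace N p 0 (insertOne N y) = y := by
  funext m
  rcases m with _ | m
  · simp [hochschildFace, insertOne, twistZero]
  · simp [hochschildFace, insertOne, twistZero]

theorem hochschildFace_last_insertOne (p : ℕ) (y : ℕ → A) :
    hochschildFace N p (p + 1) (insertOne N y) = twistedRotate N p y := by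
  funext m
  rcases m with _ | m
  · simp [hochschildFace, insertOne, twistedRotate]
  · simp [hochschildFace, insertOne, twistedRotate, twistZero]

theorem hochschildFace_succ_insertOne {p j : ℕ} (hj : j ≤ p) (y : ℕ → A) :
    hochschildFace N (p + 1) (j + 1) (insertOne N y) = insertOne N (hochschildFace N p j y) := by
  funext m
  rcases m with _ | _ | m
  · simp [hochschildFace, insertOne]; omega
  · rcases j with _ | j
    · simp [hochschildFace, insertOne, twistZero]
    · simp [hochschildFace, insertOne, twistZero]; grind
  · simp [hochschildFace, insertOne, twistZero]; grind

theorem hochschildFace_zero_twistedRotate (p : ℕ) (y : ℕ → A) :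
    hochschildFace N p 0 (twistedRotate N (p + 1) y) = hochschildFace N p (p + 1) y := by
  funext m
  rcases m with _ | m <;> simp [hochschildFace, twistedRotate, twistZero]

theorem hochschildFace_succ_twistedRotate {p j : ℕ} (hj : j ≤ p) (y : ℕ → A) :
    hochschildFace N p (j + 1) (twistedRotate N (p + 1) y) =
      twistedRotate N p (hochschildFace N p j y) := by
  funext m
  rcases m with _ | _ | m
  · rcases p with _ | p
    · obtain rfl : j = 0 := by omega
      simp [hochschildFace, twistedRotate, twistZero]
    · simp [hochschildFace, twistedRotate, twistZero]; grind
  · rcases j with _ | j <;> rcases p with _ | p <;>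
      simp [hochschildFace, twistedRotate, twistZero] <;> grind
  · simp [hochschildFace, twistedRotate, twistZero]; grind

theorem hochschildFace_iterate_of_le {p i j : ℕ} (hij : i ≤ j) (hj : j ≤ p + 1) (y : ℕ → A) :
    hochschildFace N p j ((twistedRotate N (p + 1))^[i] y) =
      (twistedRotate N p)^[i] (hochschildFace N p (j - i) y) := by
  induction i generalizing j with
  | zero => rfl
  | succ i ih =>
    obtain ⟨j, rfl⟩ : ∃ l, j = l + 1 := ⟨j - 1, by omega⟩
    rw [Function.iterate_succ_apply', Function.iterate_succ_apply',
      hochschildFace_succ_twistedRotate N (by omega), ih (by omega) (by omega)]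
    congr 3
    omega

theorem hochschildFace_iterate_of_lt {p i j : ℕ} (hij : j < i) (hi : i ≤ p + 1) (y : ℕ → A) :
    hochschildFace N p j ((twistedRotate N (p + 1))^[i] y) =
      (twistedRotate N p)^[i - 1] (hochschildFace N p (p + 2 + j - i) y) := by
  obtain ⟨l, rfl⟩ : ∃ l, i = j + (l + 1) := ⟨i - j - 1, by omega⟩
  rw [Function.iterate_add_apply, hochschildFace_iterate_of_le N le_rfl (by omega), Nat.sub_self,
    Function.iterate_succ_apply', hochschildFace_zero_twistedRotate,
    hochschildFace_iterate_of_le N (by omega) le_rfl, ← Function.iterate_add_apply]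
  congr 2
  omega

theorem twistedRotate_iterate {p i : ℕ} (hi : i ≤ p) (y : ℕ → A) (m : ℕ) :
    (twistedRotate N p)^[i + 1] y m =
      if p < m then y m
      else if m = 0 then (if i = p then N.symm (y 0) else y (p - i))
      else if m ≤ i then N.symm (y (p + m - i))
      else if m = i + 1 then N.symm (y 0) else y (m - (i + 1)) := by
  induction i generalizing m with
  | zero => simp [twistedRotate, twistZero]; grind
  | succ i ih =>
    rw [Function.iterate_succ_apply', twistedRotate]
    rcases m with _ | m
    · rw [if_pos rfl, twistZero, ih (by omega), ih (by omega)]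
      clear ih
      split_ifs <;> (congr 1 <;> omega)
    · rcases m with _ | m <;> simp only [twistZero, ih (by omega)] <;> clear ih <;> split_ifs
      all_goals first | contradiction | omega | (congr 1 <;> omega) | (congr 2; omega)

theorem twistedRotate_iterate_full (p : ℕ) (y : ℕ → A) {m : ℕ} (hm : m ≤ p) :
    (twistedRotate N p)^[p + 1] y m = N.symm (y m) := by
  rw [twistedRotate_iterate N le_rfl]
  grind

theorem seqChain_congr {p : ℕ} {y z : ℕ → A} (h : ∀ m ≤ p, y m = z m) :
    seqChain k p y = seqChain k p z := by
  unfold seqChain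
  rw [h 0 (Nat.zero_le _)]
  congr 1
  funext i
  exact h _ i.2

theorem exists_seqChain_eq {p : ℕ} (x : A) (a : Fin p → A) :
    ∃ y : ℕ → A, htensor (k := k) x a = seqChain k p y :=
  ⟨fun m => if h : m - 1 < p then if m = 0 then x else a ⟨m - 1, h⟩ else x, by
    simp [seqChain]⟩

theorem HChain.hom_ext_seqChain {M : Type*} [AddCommGroup M]
    [Module k M] {p : ℕ} {f g : HChain k A p →ₗ[k] M}
    (h : ∀ y : ℕ → A, f (seqChain k p y) = g (seqChain k p y)) : f = g :=
  HChain.hom_ext fun x a => by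
    obtain ⟨y, hy⟩ := exists_seqChain_eq (k := k) x a
    rw [hy, h]

theorem IsHochschildDiff.apply_seqChain
    {b : ∀ p : ℕ, HChain k A (p + 1) →ₗ[k] HChain k A p} (hb : IsHochschildDiff k A N b)
    (p : ℕ) (y : ℕ → A) :
    b p (seqChain k (p + 1) y) =
      ∑ j ∈ Finset.range (p + 2), ((-1 : ℤ) ^ j) • seqChain k p (hochschildFace N p j y) := by
  rw [seqChain, hb, Finset.sum_range_succ, Finset.sum_range_succ',
    ← Fin.sum_univ_eq_sum_range
      (fun j => ((-1 : ℤ) ^ (j + 1)) • seqChain k p (hochschildFace N p (j + 1) y)),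
    add_comm (∑ i : Fin p, _)]
  congr 1
  · congr 1
    · rw [pow_zero, one_smul, seqChain]
      congr 1
    · refine Finset.sum_congr rfl fun i _ => ?_
      congr 1
      rw [seqChain]
      have hi := i.2
      congr 1
      · simp [hochschildFace]; omega
      · funext j
        have hj := j.2
        simp [hochschildFace, mergeAt, Fin.ext_iff]; grind
  · congr 1
    rw [seqChain]
    congr 1
    · simp [hochschildFace]
    · funext j
      have hj := j.2
      simp [hochschildFace]

/-- The map induced by an automorphism on `Ā`. -/
noncomputable def hbarMap : HBar k A →ₗ[k] HBar k A :=
  Submodule.mapQ _ _ N.toLinearMap (by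
    rw [Submodule.span_le, Set.singleton_subset_iff]
    simp [Submodule.mem_span_singleton_self])

@[simp]
theorem hbarMap_hbar (a : A) : hbarMap N (hbar k a) = hbar k (N a) := rfl

/-- The map induced by an automorphism on Hochschild chains. -/
noncomputable def chainMap (p : ℕ) : Module.End k (HChain k A p) :=
  TensorProduct.map N.toLinearMap (PiTensorProduct.map fun _ => hbarMap N)

theorem chainMap_htensor {p : ℕ} (x : A) (a : Fin p → A) :
    chainMap N p (htensor x a) = htensor (N x) fun i => N (a i) := by
  simp [chainMap, htensor, PiTensorProduct.map_tprod]

theorem chainMap_seqChain (p : ℕ) (y : ℕ → A) :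
    chainMap N p (seqChain k p y) = seqChain k p (N ∘ y) :=
  chainMap_htensor N _ _

theorem chainMap_chainMap_symm (p : ℕ) (z : HChain k A p) :
    chainMap N p (chainMap N.symm p z) = z := by
  have h : chainMap N p ∘ₗ chainMap N.symm p = LinearMap.id :=
    HChain.hom_ext fun x a => by simp [chainMap_htensor]
  exact LinearMap.congr_fun h z

theorem comp_hochschildFace (p j : ℕ) (y : ℕ → A) :
    N ∘ hochschildFace N p j y = hochschildFace N p j (N ∘ y) := by
  funext m
  simp only [hochschildFace, Function.comp_apply, apply_ite N, map_mul]

theorem IsHochschildDiff.comm_chainMap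
    {b : ∀ p : ℕ, HChain k A (p + 1) →ₗ[k] HChain k A p} (hb : IsHochschildDiff k A N b)
    (p : ℕ) (z : HChain k A (p + 1)) :
    b p (chainMap N (p + 1) z) = chainMap N p (b p z) := by
  have h : b p ∘ₗ chainMap N (p + 1) = chainMap N p ∘ₗ b p :=
    HChain.hom_ext_seqChain fun y => by
      simp only [LinearMap.comp_apply, chainMap_seqChain, hb.apply_seqChain, map_sum, map_zsmul,
        comp_hochschildFace]
  exact LinearMap.congr_fun h z

/-- The elementary tensor in `Ā^{⊗(p+1)}` on the first `p + 1` entries of a sequence. -/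
noncomputable def seqBar (k : Type*) {A : Type*} [Field k] [Ring A] [Algebra k A] (p : ℕ)
    (y : ℕ → A) : ⨂[k]^(p + 1) (HBar k A) :=
  PiTensorProduct.tprod k fun i : Fin (p + 1) => hbar k (y i)

/-- The projection `A ⊗ Ā^{⊗p} → Ā^{⊗(p+1)}`. -/
noncomputable def chainToBar (k A : Type*) [Field k] [Ring A] [Algebra k A] (p : ℕ) :
    HChain k A p →ₗ[k] ⨂[k]^(p + 1) (HBar k A) :=
  TensorProduct.lift
    ((PiTensorProduct.lift (R := k) (s := fun _ : Fin p => HBar k A)).toLinearMap ∘ₗ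
      (PiTensorProduct.tprod k (s := fun _ : Fin (p + 1) => HBar k A)).curryLeft ∘ₗ hbar k)

theorem chainToBar_seqChain (p : ℕ) (y : ℕ → A) :
    chainToBar k A p (seqChain k p y) = seqBar k p y := by
  simp only [chainToBar, seqChain, htensor, seqBar, TensorProduct.lift.tmul, LinearMap.comp_apply,
    LinearEquiv.coe_coe, PiTensorProduct.lift.tprod, MultilinearMap.curryLeft_apply]
  congr 1
  funext i
  refine Fin.cases ?_ (fun i => ?_) i <;> simp

/-- The operator on `Ā^{⊗(p+1)}` realizing `twistZero`. -/
noncomputable def barTwist (p : ℕ) : Module.End k (⨂[k]^(p + 1) (HBar k A)) :=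
  PiTensorProduct.map fun i => if i = 0 then hbarMap N.symm else LinearMap.id

theorem barTwist_seqBar (p : ℕ) (y : ℕ → A) :
    barTwist N p (seqBar k p y) = seqBar k p (twistZero N y) := by
  rw [barTwist, seqBar, PiTensorProduct.map_tprod, seqBar]
  congr 1
  funext i
  refine Fin.cases ?_ (fun i => ?_) i <;> simp [twistZero]

/-- The operator on `Ā^{⊗(p+1)}` realizing `twistedRotate`. -/
noncomputable def barRotate (p : ℕ) : Module.End k (⨂[k]^(p + 1) (HBar k A)) :=
  (PiTensorProduct.reindex k (fun _ : Fin (p + 1) => HBar k A)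
    (finRotate (p + 1))).toLinearMap ∘ₗ barTwist N p

theorem barRotate_seqBar (p : ℕ) (y : ℕ → A) :
    barRotate N p (seqBar k p y) = seqBar k p (twistedRotate N p y) := by
  rw [barRotate, LinearMap.comp_apply, barTwist_seqBar, seqBar, LinearEquiv.coe_coe,
    PiTensorProduct.reindex_tprod, seqBar]
  congr 1
  funext i
  congr 1
  obtain ⟨j, rfl⟩ := (finRotate (p + 1)).surjective i
  rw [Equiv.symm_apply_apply]
  rcases Fin.eq_castSucc_or_eq_last j with ⟨l, rfl⟩ | rfl
  · simp [twistedRotate]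
  · simp [twistedRotate]

theorem barRotate_pow_seqBar (p i : ℕ) (y : ℕ → A) :
    (barRotate N p ^ i) (seqBar k p y) = seqBar k p ((twistedRotate N p)^[i] y) := by
  induction i with
  | zero => rfl
  | succ i ih =>
    rw [pow_succ', Module.End.mul_apply, ih, barRotate_seqBar, Function.iterate_succ_apply']

/-- The twisted Connes operator on normalized Hochschild chains. -/
noncomputable def twistedConnes (p : ℕ) : HChain k A p →ₗ[k] HChain k A (p + 1) :=
  ∑ i ∈ Finset.range (p + 1), ((-1 : ℤ) ^ (p * i)) •
    (TensorProduct.mk k A (⨂[k]^(p + 1) (HBar k A)) 1 ∘ₗ barTwist N p ∘ₗ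
      (barRotate N p ^ i) ∘ₗ chainToBar k A p)

theorem twistedConnes_seqChain (p : ℕ) (y : ℕ → A) :
    twistedConnes N p (seqChain k p y) =
      ∑ i ∈ Finset.range (p + 1), ((-1 : ℤ) ^ (p * i)) •
        seqChain k (p + 1) (insertOne N ((twistedRotate N p)^[i] y)) := by
  simp only [twistedConnes, LinearMap.sum_apply, LinearMap.smul_apply, LinearMap.comp_apply,
    chainToBar_seqChain, barRotate_pow_seqBar, barTwist_seqBar]
  rfl

theorem sum_hochschildFace_iterate {M : Type*} [AddCommGroup M] (F : (ℕ → A) → M) (p : ℕ)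
    (y : ℕ → A) :
    ∑ i ∈ Finset.range (p + 2), ∑ j ∈ Finset.range (p + 1), ((-1 : ℤ) ^ ((p + 1) * i + j)) •
        F (hochschildFace N p j ((twistedRotate N (p + 1))^[i] y)) =
      ∑ j ∈ Finset.range (p + 2), ∑ i ∈ Finset.range (p + 1), ((-1 : ℤ) ^ (p * i + j)) •
        F ((twistedRotate N p)^[i] (hochschildFace N p j y)) := by
  rw [← Finset.sum_product', ← Finset.sum_product']
  refine Finset.sum_nbij'
    (fun x => if x.1 ≤ x.2 then (x.2 - x.1, x.1) else (p + 2 + x.2 - x.1, x.1 - 1))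
    (fun x => if x.1 + x.2 ≤ p then (x.2, x.1 + x.2) else (x.2 + 1, x.1 + x.2 - (p + 1)))
    ?_ ?_ ?_ ?_ ?_
  · rintro ⟨i, j⟩ h; simp only [Finset.mem_product, Finset.mem_range] at h ⊢; grind
  · rintro ⟨i, j⟩ h; simp only [Finset.mem_product, Finset.mem_range] at h ⊢; grind
  · rintro ⟨i, j⟩ h; simp only [Finset.mem_product, Finset.mem_range] at h ⊢; grind
  · rintro ⟨i, j⟩ h; simp only [Finset.mem_product, Finset.mem_range] at h ⊢; grind
  · rintro ⟨i, j⟩ h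
    simp only [Finset.mem_product, Finset.mem_range] at h ⊢
    by_cases hij : i ≤ j
    · obtain ⟨l, rfl⟩ := Nat.exists_eq_add_of_le hij
      simp only [if_pos hij]
      rw [hochschildFace_iterate_of_le N hij (by omega), Nat.add_sub_cancel_left,
        show (p + 1) * i + (i + l) = p * i + l + 2 * i by ring, pow_add _ _ (2 * i), pow_mul _ 2]
      simp
    · obtain ⟨l, rfl⟩ := Nat.exists_eq_add_of_lt (not_le.mp hij)
      simp only [if_neg hij]
      rw [hochschildFace_iterate_of_lt N (by omega) (by omega)]
      obtain ⟨r, rfl⟩ : ∃ r, p = l + j + r := ⟨p - (l + j), by omega⟩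
      congr 1
      rw [show l + j + r + 2 + j - (j + l + 1) = r + j + 1 by omega, Nat.add_sub_cancel,
        show (l + j + r + 1) * (j + l + 1) + j
          = (l + j + r) * (j + l) + (r + j + 1) + 2 * (l + j) by ring,
        pow_add _ _ (2 * (l + j)), pow_mul _ 2]
      simp

theorem sum_alternating_iterate (p : ℕ) (y : ℕ → A) :
    ∑ i ∈ Finset.range (p + 1), (((-1 : ℤ) ^ (p * i)) • seqChain k p ((twistedRotate N p)^[i] y) +
      ((-1 : ℤ) ^ (p * i + (p + 1))) • seqChain k p ((twistedRotate N p)^[i + 1] y)) =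
      seqChain k p y - chainMap N.symm p (seqChain k p y) := by
  have h := Finset.sum_range_sub'
    (fun i => ((-1 : ℤ) ^ (p * i)) • seqChain k p ((twistedRotate N p)^[i] y)) (p + 1)
  rw [chainMap_seqChain]
  convert h using 1
  · refine Finset.sum_congr rfl fun i _ => ?_
    rw [sub_eq_add_neg, ← neg_smul]
    congr 2
    ring
  · rw [(Nat.even_mul_succ_self p).neg_one_pow,
      seqChain_congr fun m hm => twistedRotate_iterate_full N p y hm]
    simp [Function.comp_def]

theorem IsHochschildDiff.comp_twistedConnes_zero
    {b : ∀ p : ℕ, HChain k A (p + 1) →ₗ[k] HChain k A p} (hb : IsHochschildDiff k A N b)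
    (z : HChain k A 0) :
    b 0 (twistedConnes N 0 z) = z - chainMap N.symm 0 z := by
  have h : b 0 ∘ₗ twistedConnes N 0 = LinearMap.id - chainMap N.symm 0 :=
    HChain.hom_ext_seqChain fun y => by
      rw [LinearMap.sub_apply, LinearMap.id_apply, ← sum_alternating_iterate, LinearMap.comp_apply,
        twistedConnes_seqChain]
      simp [hb.apply_seqChain, Finset.sum_range_succ, hochschildFace_zero_insertOne,
        hochschildFace_last_insertOne N 0]
  exact LinearMap.congr_fun h z

theorem IsHochschildDiff.comp_twistedConnes_succ
    {b : ∀ p : ℕ, HChain k A (p + 1) →ₗ[k] HChain k A p} (hb : IsHochschildDiff k A N b)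
    (p : ℕ) (z : HChain k A (p + 1)) :
    b (p + 1) (twistedConnes N (p + 1) z) + twistedConnes N p (b p z) =
      z - chainMap N.symm (p + 1) z := by
  have h : b (p + 1) ∘ₗ twistedConnes N (p + 1) + twistedConnes N p ∘ₗ b p =
      LinearMap.id - chainMap N.symm (p + 1) :=
    HChain.hom_ext_seqChain fun y => by
      have key := sum_hochschildFace_iterate N
        (fun y => seqChain k (p + 1) (insertOne N y)) p y
      have hB : twistedConnes N p (b p (seqChain k (p + 1) y)) =
          ∑ j ∈ Finset.range (p + 2), ∑ i ∈ Finset.range (p + 1), ((-1 : ℤ) ^ (p * i + j)) •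
            seqChain k (p + 1) (insertOne N
              ((twistedRotate N p)^[i] (hochschildFace N p j y))) := by
        simp only [hb.apply_seqChain, map_sum, map_zsmul, twistedConnes_seqChain,
          Finset.smul_sum, smul_smul, ← pow_add]
        simp only [add_comm]
      rw [LinearMap.sub_apply, LinearMap.id_apply, ← sum_alternating_iterate, LinearMap.add_apply,
        LinearMap.comp_apply, LinearMap.comp_apply, hB, ← key, twistedConnes_seqChain, map_sum,
        ← Finset.sum_add_distrib]
      refine Finset.sum_congr rfl fun i _ => ?_
      rw [map_zsmul, hb.apply_seqChain, Finset.sum_range_succ, Finset.sum_range_succ',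
        hochschildFace_zero_insertOne, hochschildFace_last_insertOne, smul_add, smul_add,
        Function.iterate_succ_apply', pow_zero, one_smul, smul_smul, ← pow_add, Finset.smul_sum]
      have hc : ∑ j ∈ Finset.range (p + 1), ((-1 : ℤ) ^ ((p + 1) * i)) • ((-1 : ℤ) ^ (j + 1)) •
            seqChain k (p + 1) (hochschildFace N (p + 1) (j + 1)
              (insertOne N ((twistedRotate N (p + 1))^[i] y))) =
          -∑ j ∈ Finset.range (p + 1), ((-1 : ℤ) ^ ((p + 1) * i + j)) •
            seqChain k (p + 1) (insertOne N
              (hochschildFace N p j ((twistedRotate N (p + 1))^[i] y))) := by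
        rw [← Finset.sum_neg_distrib]
        refine Finset.sum_congr rfl fun j hj => ?_
        rw [hochschildFace_succ_insertOne N (Nat.lt_succ_iff.mp (Finset.mem_range.mp hj)),
          smul_smul, ← neg_smul]
        congr 1
        ring
      rw [hc]
      abel
  exact LinearMap.congr_fun h z

end Tuples

section Diagonalizable

variable {k V : Type*} [Field k] [AddCommGroup V] [Module k V]

theorem Module.End.eq_eigenspace_of_le_of_iSup_eq_top {T : Module.End k V}
    {C : k → Submodule k V} (hle : ∀ μ, C μ ≤ T.eigenspace μ) (htop : ⨆ μ, C μ = ⊤) (μ : k) :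
    C μ = T.eigenspace μ := by
  refine le_antisymm (hle μ) (le_of_eq ?_)
  have hdisj := (T.eigenspaces_iSupIndep μ).mono_right
    (iSup₂_mono fun ν (_ : ν ≠ μ) => hle ν)
  have hsup : C μ ⊔ ⨆ ν, ⨆ _ : ν ≠ μ, C ν = ⊤ := by
    rw [eq_top_iff, ← htop]
    refine iSup_le fun ν => ?_
    by_cases h : ν = μ
    · exact h ▸ le_sup_left
    · exact le_sup_of_le_right (le_iSup₂_of_le ν h le_rfl)
  calc T.eigenspace μ = (C μ ⊔ ⨆ ν, ⨆ _ : ν ≠ μ, C ν) ⊓ T.eigenspace μ := by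
        rw [hsup, top_inf_eq]
    _ = C μ ⊔ (⨆ ν, ⨆ _ : ν ≠ μ, C ν) ⊓ T.eigenspace μ := sup_inf_assoc_of_le _ (hle μ)
    _ = C μ := by rw [inf_comm, hdisj.eq_bot, sup_bot_eq]

theorem Module.End.isCompl_eigenspace_range {T : Module.End k V}
    (htop : ⨆ μ, T.eigenspace μ = ⊤) (μ : k) :
    IsCompl (T.eigenspace μ) (LinearMap.range (T - algebraMap k _ μ)) := by
  constructor
  · refine (T.eigenspaces_iSupIndep μ).mono_right ?_
    rw [LinearMap.range_eq_map, ← htop, Submodule.map_iSup]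
    refine iSup_le fun ν => ?_
    rintro _ ⟨x, hx, rfl⟩
    have hx' : T x = ν • x := Module.End.mem_eigenspace_iff.mp hx
    rw [LinearMap.sub_apply, Module.algebraMap_end_apply, hx', ← sub_smul]
    by_cases h : ν = μ
    · simp [h]
    · exact Submodule.smul_mem _ _
        ((le_iSup₂_of_le (f := fun ν (_ : ν ≠ μ) => T.eigenspace ν) ν h le_rfl) hx)
  · rw [codisjoint_iff, eq_top_iff, ← htop]
    refine iSup_le fun ν => ?_
    by_cases h : ν = μ
    · exact h ▸ le_sup_left
    · refine le_sup_of_le_right fun x hx => ⟨(ν - μ)⁻¹ • x, ?_⟩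
      have hx' : T x = ν • x := Module.End.mem_eigenspace_iff.mp hx
      rw [map_smul, LinearMap.sub_apply, Module.algebraMap_end_apply, hx', ← sub_smul,
        inv_smul_smul₀ (sub_ne_zero.mpr h)]

end Diagonalizable

section Decomposition

variable {k A : Type*} [Field k] [Ring A] [Algebra k A] (N : A ≃ₐ[k] A)

theorem eigChain_le_eigenspace (lam : k) (p : ℕ) :
    eigChain k A N.toLinearMap lam p ≤ (chainMap N p).eigenspace lam := by
  refine Submodule.span_le.mpr ?_
  rintro _ ⟨l, ls, x, a, hx, ha, rfl, rfl⟩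
  have hx' : N x = l • x := Module.End.mem_eigenspace_iff.mp hx
  have ha' : ∀ i, N (a i) = ls i • a i := fun i => Module.End.mem_eigenspace_iff.mp (ha i)
  refine Module.End.mem_eigenspace_iff.mpr ?_
  rw [chainMap_htensor, hx']
  simp only [ha', htensor, map_smul]
  rw [MultilinearMap.map_smul_univ, TensorProduct.smul_tmul_smul]

theorem iSup_eigChain_eq_top
    (hdiag : ⨆ μ : k, Module.End.eigenspace (N.toLinearMap) μ = ⊤) (p : ℕ) :
    ⨆ lam : k, eigChain k A N.toLinearMap lam p = ⊤ := by
  have hdec : ∀ x : A, ∃ f : k →₀ A,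
      (∀ μ, f μ ∈ Module.End.eigenspace N.toLinearMap μ) ∧ ∑ μ ∈ f.support, f μ = x := fun x =>
    (Submodule.mem_iSup_iff_exists_finsupp _ x).mp (hdiag ▸ Submodule.mem_top)
  suffices h : (⨆ lam : k, eigChain k A N.toLinearMap lam p).mkQ = 0 by
    rw [← Submodule.ker_mkQ (⨆ lam : k, eigChain k A N.toLinearMap lam p), h, LinearMap.ker_zero]
  refine HChain.hom_ext fun x a => ?_
  rw [LinearMap.zero_apply, Submodule.mkQ_apply, Submodule.Quotient.mk_eq_zero]
  obtain ⟨f, hf, rfl⟩ := hdec x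
  choose g hg hga using fun i => hdec (a i)
  obtain rfl : (fun i => ∑ μ ∈ (g i).support, g i μ) = a := funext hga
  simp only [htensor, map_sum, MultilinearMap.map_sum_finset, TensorProduct.sum_tmul,
    TensorProduct.tmul_sum]
  refine Submodule.sum_mem _ fun ls _ => Submodule.sum_mem _ fun l _ => ?_
  exact Submodule.mem_iSup_of_mem (l * ∏ i, ls i) (Submodule.subset_span
    ⟨l, ls, f l, fun i => g i (ls i), hf l, fun i => hg i (ls i), rfl, rfl⟩)

theorem eigChain_eq_eigenspace
    (hdiag : ⨆ μ : k, Module.End.eigenspace (N.toLinearMap) μ = ⊤) (lam : k) (p : ℕ) :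
    eigChain k A N.toLinearMap lam p = (chainMap N p).eigenspace lam :=
  Module.End.eq_eigenspace_of_le_of_iSup_eq_top (fun _ => eigChain_le_eigenspace N _ p)
    (iSup_eigChain_eq_top N hdiag p) lam

theorem isCompl_eigChain_range
    (hdiag : ⨆ μ : k, Module.End.eigenspace (N.toLinearMap) μ = ⊤) (p : ℕ) :
    IsCompl (eigChain k A N.toLinearMap 1 p) (LinearMap.range (chainMap N p - 1)) := by
  have htop : ⨆ μ, (chainMap N p).eigenspace μ = ⊤ := by
    simp only [← eigChain_eq_eigenspace N hdiag, iSup_eigChain_eq_top N hdiag]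
  simpa [eigChain_eq_eigenspace N hdiag] using Module.End.isCompl_eigenspace_range htop 1

end Decomposition

/-- for a diagonalizable automorphism `N` with eigenvalues in `k`, the
normalized Hochschild chain complex decomposes as the direct sum of the subcomplexes
`C_*^λ(A,A_N)`, and the inclusion of `C_*^1(A,A_N)` induces an isomorphism on homology
in every degree; in particular `HH_*(A,A_N) ≅ HH_*^1(A,A_N)`. -/
theorem stmt_5 (k A : Type*) [Field k] [Ring A] [Algebra k A] [FiniteDimensional k A]
    (N : A ≃ₐ[k] A)
    (hdiag : ⨆ μ : k, Module.End.eigenspace (N.toLinearMap) μ = ⊤)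
    (b : ∀ p : ℕ, HChain k A (p + 1) →ₗ[k] HChain k A p)
    (hb : IsHochschildDiff k A (⇑N) b) :
    -- direct sum decomposition into subcomplexes
    (∀ p : ℕ, iSupIndep (fun lam : k => eigChain k A N.toLinearMap lam p) ∧
      (⨆ lam : k, eigChain k A N.toLinearMap lam p) = ⊤) ∧
    (∀ (p : ℕ) (lam : k) (z : HChain k A (p + 1)),
      z ∈ eigChain k A N.toLinearMap lam (p + 1) → b p z ∈ eigChain k A N.toLinearMap lam p) ∧
    -- the inclusion of the subcomplex for eigenvalue 1 is a quasi-isomorphism: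
    -- surjectivity on homology
    (∀ z : HChain k A 0, ∃ z' ∈ eigChain k A N.toLinearMap 1 0,
      ∃ w : HChain k A 1, z = z' + b 0 w) ∧
    (∀ (p : ℕ) (z : HChain k A (p + 1)), b p z = 0 →
      ∃ z' ∈ eigChain k A N.toLinearMap 1 (p + 1), b p z' = 0 ∧
        ∃ w : HChain k A (p + 2), z = z' + b (p + 1) w) ∧
    -- injectivity on homology
    (∀ z ∈ eigChain k A N.toLinearMap 1 0, (∃ w : HChain k A 1, b 0 w = z) →
      ∃ w' ∈ eigChain k A N.toLinearMap 1 1, b 0 w' = z) ∧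
    (∀ (p : ℕ) (z : HChain k A (p + 1)), z ∈ eigChain k A N.toLinearMap 1 (p + 1) →
      b p z = 0 → (∃ w : HChain k A (p + 2), b (p + 1) w = z) →
      ∃ w' ∈ eigChain k A N.toLinearMap 1 (p + 2), b (p + 1) w' = z) := by
  have hE := fun lam p => eigChain_eq_eigenspace N hdiag lam p
  have hC := fun p => isCompl_eigChain_range N hdiag p
  have hcomm := hb.comm_chainMap N
  have hsub : ∀ (p : ℕ) (lam : k) (z : HChain k A (p + 1)),
      z ∈ eigChain k A N.toLinearMap lam (p + 1) → b p z ∈ eigChain k A N.toLinearMap lam p := by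
    intro p lam z hz
    rw [hE, Module.End.mem_eigenspace_iff] at hz ⊢
    rw [← hcomm, hz, map_smul]
  have hrange : ∀ p u, b p ((chainMap N (p + 1) - 1) u) = (chainMap N p - 1) (b p u) := by
    intro p u
    simp [hcomm]
  have hdec : ∀ p (z : HChain k A p), ∃ z' ∈ eigChain k A N.toLinearMap 1 p,
      ∃ u ∈ LinearMap.range (chainMap N p - 1), z = z' + (chainMap N p - 1) u := by
    intro p z
    have hmem : ∀ z : HChain k A p, ∃ y ∈ eigChain k A N.toLinearMap 1 p, ∃ v,
        y + (chainMap N p - 1) v = z := by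
      intro z
      obtain ⟨y, hy, _, ⟨v, rfl⟩, h⟩ := Submodule.mem_sup.mp
        ((hC p).sup_eq_top ▸ Submodule.mem_top (x := z))
      exact ⟨y, hy, v, h⟩
    obtain ⟨z', hz', v, rfl⟩ := hmem z
    obtain ⟨y, hy, w, rfl⟩ := hmem v
    refine ⟨z', hz', _, ⟨w, rfl⟩, ?_⟩
    rw [hE, Module.End.mem_eigenspace_iff, one_smul] at hy
    simp [hy]
  have hzero : ∀ p (x : HChain k A p), x ∈ eigChain k A N.toLinearMap 1 p →
      x ∈ LinearMap.range (chainMap N p - 1) → x = 0 := fun p _ h₁ h₂ =>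
    (Submodule.disjoint_def.mp (hC p).disjoint) _ h₁ h₂
  have hinj : ∀ (p : ℕ) (z : HChain k A p), z ∈ eigChain k A N.toLinearMap 1 p →
      (∃ w, b p w = z) → ∃ w' ∈ eigChain k A N.toLinearMap 1 (p + 1), b p w' = z := by
    rintro p _ hz ⟨w, rfl⟩
    obtain ⟨w', hw', u, -, rfl⟩ := hdec _ w
    refine ⟨w', hw', ?_⟩
    rw [map_add, hrange] at hz ⊢
    rw [hzero p ((chainMap N p - 1) (b p u)) ?_ ⟨_, rfl⟩, add_zero]
    simpa using Submodule.sub_mem _ hz (hsub p 1 w' hw')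
  refine ⟨fun p => ⟨?_, iSup_eigChain_eq_top N hdiag p⟩, hsub, ?_, ?_, hinj 0,
    fun p z hz _ => hinj (p + 1) z hz⟩
  · simpa only [hE] using (chainMap N p).eigenspaces_iSupIndep
  · intro z
    obtain ⟨z', hz', u, -, rfl⟩ := hdec _ z
    refine ⟨z', hz', chainMap N 1 (twistedConnes N 0 u), ?_⟩
    rw [hcomm, hb.comp_twistedConnes_zero, map_sub, chainMap_chainMap_symm]
    rfl
  · intro p z hz
    obtain ⟨z', hz', u, ⟨v, rfl⟩, rfl⟩ := hdec _ z
    rw [map_add, hrange] at hz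
    have hbu : (chainMap N p - 1) (b p ((chainMap N (p + 1) - 1) v)) = 0 := by
      refine hzero p _ ?_ ⟨_, rfl⟩
      rw [eq_neg_of_add_eq_zero_right hz]
      exact Submodule.neg_mem _ (hsub p 1 z' hz')
    rw [hbu, add_zero] at hz
    have hbv : b p ((chainMap N (p + 1) - 1) v) = 0 := by
      refine hzero p _ ?_ ⟨b p v, (hrange p v).symm⟩
      rw [hE, Module.End.mem_eigenspace_iff, one_smul]
      exact sub_eq_zero.mp hbu
    refine ⟨z', hz', hz,
      chainMap N (p + 2) (twistedConnes N (p + 1) ((chainMap N (p + 1) - 1) v)), ?_⟩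
    have hB := hb.comp_twistedConnes_succ N p ((chainMap N (p + 1) - 1) v)
    rw [hbv, map_zero, add_zero] at hB
    rw [hcomm, hB, map_sub, chainMap_chainMap_symm]
    rfl
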